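/- Let (v_n) be a positive sequence in GS(v*), let (γ_n) ⊂ (0,1) be a positive sequence in GS(−α) with α ∈ (1/2,1] such that ξ := lim_{n→∞} (nγ_n)^{−1} exists, and let l > 0 satisfy l − v*·ξ > 0. Then for every positive sequence (α_n) with lim_{n→∞} α_n = 0 and every δ ∈ ℝ, one has lim_{n→∞} v_n Π_n^l [ Σ_{k=1}^n Π_k^{−l} (γ_k / v_k) α_k + δ ] = 0, where Π_n = ∏_{j=1}^n (1−γ_j). -/

import Mathlib

open MeasureTheory Filter Finset Real

noncomputable section

/-- Bernstein basis polynomial `b_k(m,x) = C(m,k) x^k (1-x)^(m-k)`. -/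
def bern (m k : ℕ) (x : ℝ) : ℝ := (m.choose k : ℝ) * x ^ k * (1 - x) ^ (m - k)

/-- `T_{n,m}(x)` built from the observation `t = X_n`:
`T_{n,m}(x) = m ∑_{k=0}^{m-1} 1{k/m < X_n ≤ (k+1)/m} b_k(m-1,x)`. -/
def Tstat (m : ℕ) (t x : ℝ) : ℝ :=
  (m : ℝ) * ∑ k ∈ Finset.range m,
    (if (k : ℝ) / (m : ℝ) < t ∧ t ≤ ((k : ℝ) + 1) / (m : ℝ) then (1 : ℝ) else 0)
      * bern (m - 1) k x

/-- `Z_n(x) = 2 T_{n,m_n}(x) - T_{n,m_n/2}(x)`. -/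
def Zstat (m : ℕ) (t x : ℝ) : ℝ := 2 * Tstat m t x - Tstat (m / 2) t x

/-- `Π_n = ∏_{j=1}^n (1 - γ_j)`. -/
def Pprod (γ : ℕ → ℝ) (n : ℕ) : ℝ := ∏ j ∈ Finset.Icc 1 n, (1 - γ j)

/-- The recursive estimator `f_n(x) = Π_n ∑_{k=1}^n Π_k⁻¹ γ_k Z_k(x)`, evaluated at the
sample point `ω`. -/
def fhat {Ω : Type*} (X : ℕ → Ω → ℝ) (γ : ℕ → ℝ) (m : ℕ → ℕ) (x : ℝ) (n : ℕ) (ω : Ω) : ℝ :=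
  Pprod γ n * ∑ k ∈ Finset.Icc 1 n, (Pprod γ k)⁻¹ * γ k * Zstat (m k) (X k ω) x

/-- A positive sequence `(v_n)` belongs to `GS(c)`:
`lim_{n→∞} n (1 - v_{n-1}/v_n) = c`. -/
def IsGS (v : ℕ → ℝ) (c : ℝ) : Prop :=
  (∀ n, 0 < v n) ∧ Tendsto (fun n : ℕ => (n : ℝ) * (1 - v (n - 1) / v n)) atTop (nhds c)

/-- `Δ₂(x)`, with derivatives of `f` taken within `[0,1]`. -/
def Δ₂ (f : ℝ → ℝ) (x : ℝ) : ℝ :=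
  (1 / 6) * (1 - 6 * x * (1 - x)) * iteratedDerivWithin 2 f (Set.Icc 0 1) x
    + (5 / 12) * x * (1 - x) * (1 - 2 * x) * iteratedDerivWithin 3 f (Set.Icc 0 1) x
    + (1 / 8) * x ^ 2 * (1 - x) ^ 2 * iteratedDerivWithin 4 f (Set.Icc 0 1) x

/-- `ψ(x) = (4πx(1-x))^{-1/2}`. -/
def ψfun (x : ℝ) : ℝ := (4 * π * x * (1 - x)) ^ (-(1 : ℝ) / 2)

/-- `C₃ = 1/√2 + 4(1 - √(2/3))`. -/
def C₃ : ℝ := 1 / Real.sqrt 2 + 4 * (1 - Real.sqrt (2 / 3))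

/-- `C₁ = ∫₀¹ f(x) ψ(x) dx`. -/
def C₁ (f : ℝ → ℝ) : ℝ := ∫ x in (0 : ℝ)..1, f x * ψfun x

/-- `C₂ = ∫₀¹ Δ₂(x)² dx`. -/
def C₂ (f : ℝ → ℝ) : ℝ := ∫ x in (0 : ℝ)..1, (Δ₂ f x) ^ 2

open Topology in
/-- A nonnegative sequence contracted by factors `1 - g n` with `∑ g n = ∞` tends to `0`. -/
theorem tendsto_zero_of_le_one_sub_mul {y g : ℕ → ℝ} {N : ℕ} (hy : ∀ n, 0 ≤ y n)
    (hg : ∀ n, 0 ≤ g n) (hsum : ¬ Summable g)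
    (hrec : ∀ n, N ≤ n → y (n + 1) ≤ (1 - g (n + 1)) * y n) :
    Tendsto y atTop (𝓝 0) := by
  have hbound : ∀ n, y (n + N) ≤ Real.exp (-∑ k ∈ Finset.range n, g (k + (N + 1))) * y N := by
    intro n
    induction n with
    | zero => simp
    | succ n ih =>
      have hstep := hrec (n + N) (Nat.le_add_left _ _)
      have hexp := Real.add_one_le_exp (-g (n + (N + 1)))
      rw [show n + 1 + N = n + N + 1 by ring]
      calc y (n + N + 1) ≤ (1 - g (n + N + 1)) * y (n + N) := hstep
        _ ≤ Real.exp (-g (n + (N + 1))) * y (n + N) :=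
          mul_le_mul_of_nonneg_right (by rw [add_assoc]; linarith) (hy _)
        _ ≤ Real.exp (-g (n + (N + 1))) *
            (Real.exp (-∑ k ∈ Finset.range n, g (k + (N + 1))) * y N) :=
          mul_le_mul_of_nonneg_left ih (Real.exp_pos _).le
        _ = _ := by
          rw [Finset.sum_range_succ, neg_add, Real.exp_add]
          ring
  have hdiv : Tendsto (fun n => ∑ k ∈ Finset.range n, g (k + (N + 1))) atTop atTop :=
    (not_summable_iff_tendsto_nat_atTop_of_nonneg fun k => hg _).1
      (mt (summable_nat_add_iff (N + 1)).1 hsum)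
  have hlim : Tendsto (fun n => Real.exp (-∑ k ∈ Finset.range n, g (k + (N + 1))) * y N)
      atTop (𝓝 0) := by
    simpa using (Real.tendsto_exp_neg_atTop_nhds_zero.comp hdiv).mul_const (y N)
  exact (tendsto_add_atTop_iff_nat N).1 (squeeze_zero (fun n => hy _) hbound hlim)

open Topology in
/-- A nonnegative sequence with `x (n + 1) ≤ (1 - g (n + 1)) * x n + g (n + 1) * e (n + 1)`
eventually, where `0 ≤ g ≤ 1`, `∑ g n = ∞` and `e` tends to `0`, tends to `0`. -/
theorem tendsto_zero_of_le_convex_comb {x g e : ℕ → ℝ} (hx : ∀ n, 0 ≤ x n)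
    (hg : ∀ n, 0 ≤ g n) (hg1 : ∀ n, g n ≤ 1) (hsum : ¬ Summable g)
    (he : Tendsto e atTop (𝓝 0))
    (hrec : ∀ᶠ n in atTop, x (n + 1) ≤ (1 - g (n + 1)) * x n + g (n + 1) * e (n + 1)) :
    Tendsto x atTop (𝓝 0) := by
  refine Metric.tendsto_atTop.2 fun ε hε => ?_
  have he' : ∀ᶠ n in atTop, e (n + 1) < ε / 2 :=
    ((tendsto_add_atTop_iff_nat 1).2 he).eventually_lt_const (half_pos hε)
  obtain ⟨N, hN⟩ := eventually_atTop.1 (hrec.and he')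
  have hy : Tendsto (fun n => max (x n - ε / 2) 0) atTop (𝓝 0) := by
    refine tendsto_zero_of_le_one_sub_mul (N := N) (fun n => le_max_right _ _) hg hsum ?_
    intro n hn
    obtain ⟨h1, h2⟩ := hN n hn
    have hc : 0 ≤ 1 - g (n + 1) := sub_nonneg.2 (hg1 _)
    refine max_le ?_ (mul_nonneg hc (le_max_right _ _))
    have h3 := mul_le_mul_of_nonneg_left (le_max_left (x n - ε / 2) 0) hc
    have h4 := mul_le_mul_of_nonneg_left h2.le (hg (n + 1))
    linarith
  obtain ⟨M, hM⟩ := eventually_atTop.1 (hy.eventually_lt_const (half_pos hε))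
  refine ⟨M, fun n hn => ?_⟩
  have h := (le_max_left _ _).trans_lt (hM n hn)
  rw [Real.dist_eq, sub_zero, abs_of_nonneg (hx n)]
  linarith

open Topology in
/-- If `(n γ n)⁻¹` converges, then the positive sequence `γ` dominates a multiple of the harmonic
sequence and so is not summable. -/
theorem not_summable_of_tendsto_inv_natCast_mul {γ : ℕ → ℝ} {ξ : ℝ} (hγ : ∀ n, 0 < γ n)
    (hξ : Tendsto (fun n : ℕ => ((n : ℝ) * γ n)⁻¹) atTop (𝓝 ξ)) : ¬ Summable γ := by
  intro hs
  refine Real.not_summable_one_div_natCast ?_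
  obtain ⟨N, hN⟩ := eventually_atTop.1
    (hξ.eventually_lt_const (lt_of_le_of_lt (le_abs_self ξ) (lt_add_one _)))
  refine Summable.of_norm_bounded_eventually_nat (hs.mul_left (|ξ| + 1)) ?_
  filter_upwards [eventually_ge_atTop N, eventually_gt_atTop 0] with n hn hn0
  have hpos : (0 : ℝ) < n := Nat.cast_pos.2 hn0
  have h := mul_le_mul_of_nonneg_right (hN n hn).le (hγ n).le
  have hne := (hγ n).ne'
  rw [mul_inv, mul_assoc, inv_mul_cancel₀ hne, mul_one] at h
  rwa [Real.norm_of_nonneg (by positivity), one_div]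

open Topology in
/-- If `v ∈ GS(c)` and `(n γ n)⁻¹ → ξ`, then `v n / v (n - 1) - 1 = (c ξ + o(1)) γ n`. -/
theorem IsGS.tendsto_ratio_sub_one_div {v γ : ℕ → ℝ} {c ξ : ℝ} (hv : IsGS v c)
    (hξ : Tendsto (fun n : ℕ => ((n : ℝ) * γ n)⁻¹) atTop (𝓝 ξ)) :
    Tendsto (fun n => (v n / v (n - 1) - 1) / γ n) atTop (𝓝 (c * ξ)) := by
  have ha : Tendsto (fun n => 1 - v (n - 1) / v n) atTop (𝓝 0) := by
    have h := hv.2.mul (tendsto_inv_atTop_nhds_zero_nat (𝕜 := ℝ))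
    rw [mul_zero] at h
    refine h.congr' ?_
    filter_upwards [eventually_gt_atTop 0] with n hn
    have hne : (n : ℝ) ≠ 0 := Nat.cast_ne_zero.2 hn.ne'
    field_simp
  have hr : Tendsto (fun n => v n / v (n - 1)) atTop (𝓝 1) := by
    have h := (ha.const_sub 1).inv₀ (by norm_num)
    simpa using h
  have h := (hv.2.mul hξ).mul hr
  rw [mul_one] at h
  refine h.congr' ?_
  filter_upwards [eventually_gt_atTop 0] with n hn
  have hne : (n : ℝ) ≠ 0 := Nat.cast_ne_zero.2 hn.ne'
  have h1 := (hv.1 n).ne'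
  have h2 := (hv.1 (n - 1)).ne'
  rw [mul_inv]
  field_simp

theorem Pprod_succ (γ : ℕ → ℝ) (n : ℕ) : Pprod γ (n + 1) = Pprod γ n * (1 - γ (n + 1)) :=
  Finset.prod_Icc_succ_top (Nat.le_add_left 1 n) _

theorem Pprod_pos {γ : ℕ → ℝ} (hγ : ∀ n, γ n < 1) (n : ℕ) : 0 < Pprod γ n :=
  Finset.prod_pos fun j _ => sub_pos.2 (hγ j)

/-- Chord bound for the convex function `t ↦ exp (-c t)` on `[0, 1]`. -/
theorem exp_neg_mul_le_one_sub {c t : ℝ} (ht0 : 0 ≤ t) (ht1 : t ≤ 1) :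
    Real.exp (-(c * t)) ≤ 1 - (1 - Real.exp (-c)) * t := by
  have h := convexOn_exp.2 (Set.mem_univ 0) (Set.mem_univ (-c)) (sub_nonneg.2 ht1) ht0
    (sub_add_cancel 1 t)
  simp only [smul_eq_mul, mul_zero, zero_add, Real.exp_zero, mul_one] at h
  rw [show t * -c = -(c * t) by ring] at h
  linarith

/-- Mokkadem–Pelletier technical lemma, second part: under the same assumptions,
for every positive sequence `(α_n)` tending to `0` and every `δ ∈ ℝ`,
`lim_n v_n Π_n^l [∑_{k=1}^n Π_k^{-l} (γ_k / v_k) α_k + δ] = 0`. -/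
theorem technical_lemma_part2 (v γ : ℕ → ℝ) (vstar α ξ l : ℝ)
    (hv : IsGS v vstar)
    (hγ01 : ∀ n, γ n ∈ Set.Ioo (0 : ℝ) 1)
    (hγ : IsGS γ (-α)) (hα : α ∈ Set.Ioc (1 / 2 : ℝ) 1)
    (hξ : Tendsto (fun n : ℕ => ((n : ℝ) * γ n)⁻¹) atTop (nhds ξ))
    (hl : 0 < l) (hlv : l - vstar * ξ > 0)
    (α' : ℕ → ℝ) (hα'pos : ∀ n, 0 < α' n) (hα'lim : Tendsto α' atTop (nhds 0))
    (δ : ℝ) :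
    Tendsto (fun n : ℕ =>
        v n * (Pprod γ n) ^ l
          * ((∑ k ∈ Finset.Icc 1 n, (Pprod γ k) ^ (-l) * (γ k / v k) * α' k) + δ))
      atTop (nhds 0) := by
  have hγpos : ∀ n, 0 < γ n := fun n => (hγ01 n).1
  have hP := Pprod_pos fun n => (hγ01 n).2
  set c := (l - vstar * ξ) / 2 with hc
  set κ := 1 - Real.exp (-c) with hκ
  have hcpos : 0 < c := half_pos hlv
  have hκpos : 0 < κ := sub_pos.2 (Real.exp_lt_one_iff.2 (neg_lt_zero.2 hcpos))
  have hκ1 : κ ≤ 1 := sub_le_self _ (Real.exp_pos _).le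
  have hfactor : ∀ᶠ n in atTop,
      v (n + 1) / v n * (1 - γ (n + 1)) ^ l ≤ 1 - κ * γ (n + 1) := by
    have h := (tendsto_add_atTop_iff_nat 1).2 (hv.tendsto_ratio_sub_one_div hξ)
    filter_upwards [h.eventually_lt_const (show vstar * ξ < l - c by linarith)] with n hn
    rw [Nat.add_sub_cancel, div_lt_iff₀ (hγpos _)] at hn
    have h1 : v (n + 1) / v n ≤ Real.exp ((l - c) * γ (n + 1)) := by
      linarith [Real.add_one_le_exp ((l - c) * γ (n + 1))]
    have h2 : (1 - γ (n + 1)) ^ l ≤ Real.exp (-(γ (n + 1)) * l) := by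
      rw [Real.exp_mul]
      exact Real.rpow_le_rpow (sub_pos.2 (hγ01 _).2).le (Real.one_sub_le_exp_neg _) hl.le
    calc _ ≤ Real.exp ((l - c) * γ (n + 1)) * Real.exp (-(γ (n + 1)) * l) :=
          mul_le_mul h1 h2 (Real.rpow_nonneg (sub_pos.2 (hγ01 _).2).le _) (Real.exp_pos _).le
      _ = Real.exp (-(c * γ (n + 1))) := by rw [← Real.exp_add]; ring_nf
      _ ≤ _ := exp_neg_mul_le_one_sub (hγpos _).le (hγ01 _).2.le
  refine (tendsto_zero_iff_abs_tendsto_zero _).2 ?_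
  refine tendsto_zero_of_le_convex_comb (g := fun n => κ * γ n) (e := fun n => α' n / κ)
    (fun n => abs_nonneg _) (fun n => (mul_pos hκpos (hγpos n)).le)
    (fun n => mul_le_one₀ hκ1 (hγpos n).le (hγ01 n).2.le)
    (fun h => not_summable_of_tendsto_inv_natCast_mul hγpos hξ
      ((summable_mul_left_iff hκpos.ne').1 h))
    (by simpa using hα'lim.div_const κ) ?_
  filter_upwards [hfactor] with n hn
  have hv0 := hv.1 n
  have hv1 := hv.1 (n + 1)
  have h1γ : 0 < 1 - γ (n + 1) := sub_pos.2 (hγ01 _).2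
  have hsucc : Pprod γ (n + 1) ^ l = Pprod γ n ^ l * (1 - γ (n + 1)) ^ l := by
    rw [Pprod_succ, Real.mul_rpow (hP n).le h1γ.le]
  have hcancel : Pprod γ (n + 1) ^ l * Pprod γ (n + 1) ^ (-l) = 1 := by
    rw [← Real.rpow_add (hP _), add_neg_cancel, Real.rpow_zero]
  simp only [Function.comp_apply]
  rw [Finset.sum_Icc_succ_top (Nat.le_add_left 1 n)]
  set S := (∑ k ∈ Finset.Icc 1 n, Pprod γ k ^ (-l) * (γ k / v k) * α' k) + δ
  have hrec : v (n + 1) * Pprod γ (n + 1) ^ l *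
      ((∑ k ∈ Finset.Icc 1 n, Pprod γ k ^ (-l) * (γ k / v k) * α' k)
        + Pprod γ (n + 1) ^ (-l) * (γ (n + 1) / v (n + 1)) * α' (n + 1) + δ)
      = v (n + 1) / v n * (1 - γ (n + 1)) ^ l * (v n * Pprod γ n ^ l * S)
        + γ (n + 1) * α' (n + 1) := by
    calc _ = v (n + 1) * Pprod γ (n + 1) ^ l * S
          + (Pprod γ (n + 1) ^ l * Pprod γ (n + 1) ^ (-l))
            * (v (n + 1) * (γ (n + 1) / v (n + 1))) * α' (n + 1) := by ring
      _ = _ := by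
        rw [hcancel, hsucc, mul_div_cancel₀ _ hv1.ne']
        field_simp
  rw [hrec, show κ * γ (n + 1) * (α' (n + 1) / κ) = γ (n + 1) * α' (n + 1) by field_simp]
  refine (abs_add_le _ _).trans (add_le_add ?_ ?_)
  · rw [abs_mul, abs_of_nonneg (mul_nonneg (div_pos hv1 hv0).le (Real.rpow_nonneg h1γ.le _))]
    exact mul_le_mul_of_nonneg_right hn (abs_nonneg _)
  · exact (abs_of_pos (mul_pos (hγpos _) (hα'pos _))).le
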